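/- arXiv:1909.01000 — 3 statements merged into one kernel-verified Lean document; each statement's English description precedes it below -/
import Mathlib

section
/- Let 𝔥 ⊆ 𝔤 be a linear subspace. Then the cocommutator satisfies the coisotropy condition δ(X) ∈ 𝔥 ∧ 𝔤 for all X ∈ 𝔥 if and only if the annihilator 𝔥^⊥ is a Lie subalgebra of (𝔤*, [·,·]_*), i.e. [φ,ψ]_* ∈ 𝔥^⊥ for all φ, ψ ∈ 𝔥^⊥. -/
open TensorProduct

/-- For subspaces `U V ⊆ 𝔤`, the subspace `U ⊗ V` of `𝔤 ⊗ 𝔤` spanned by the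
tensors `u ⊗ v` with `u ∈ U`, `v ∈ V`. -/
def tensorSub {K : Type*} [Field K] {g : Type*} [AddCommGroup g] [Module K g]
    (U V : Submodule K g) : Submodule K (TensorProduct K g g) :=
  Submodule.span K (Set.image2 (fun x y => x ⊗ₜ[K] y) (U : Set g) (V : Set g))

/-- Pairs of functionals separate the points of a tensor product of finite-dimensional spaces. -/
theorem TensorProduct.eq_zero_of_forall_map_dual_eq_zero {K M N : Type*} [Field K]
    [AddCommGroup M] [Module K M] [AddCommGroup N] [Module K N]
    [FiniteDimensional K M] [FiniteDimensional K N] (t : M ⊗[K] N)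
    (ht : ∀ (φ : Module.Dual K M) (ψ : Module.Dual K N), TensorProduct.map φ ψ t = 0) :
    t = 0 := by
  rw [← Module.forall_dual_apply_eq_zero_iff K]
  intro f
  obtain ⟨w, rfl⟩ := (TensorProduct.dualDistribEquiv K M N).surjective f
  change TensorProduct.dualDistrib K M N w t = 0
  induction w with
  | zero => simp
  | add x y hx hy => simp [hx, hy]
  | tmul φ ψ =>
    change TensorProduct.lid K K (TensorProduct.map φ ψ t) = 0
    rw [ht, map_zero]

/-- The subspace `h ⊗ g + g ⊗ h` contains the kernel of the projection `g ⊗ g → g/h ⊗ g/h`. -/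
theorem ker_map_mkQ_le_tensorSub_sup {K g : Type*} [Field K] [AddCommGroup g] [Module K g]
    (h : Submodule K g) :
    LinearMap.ker (TensorProduct.map h.mkQ h.mkQ) ≤ tensorSub h ⊤ ⊔ tensorSub ⊤ h := by
  have hex : Function.Exact h.subtype h.mkQ := LinearMap.exact_subtype_mkQ h
  rw [TensorProduct.map_ker hex h.mkQ_surjective hex h.mkQ_surjective, sup_comm]
  refine sup_le_sup ?_ ?_
  · rintro _ ⟨t, rfl⟩
    induction t with
    | zero => simp
    | add x y hx hy => rw [map_add]; exact add_mem hx hy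
    | tmul x y => exact Submodule.subset_span ⟨x, x.2, y, trivial, rfl⟩
  · rintro _ ⟨t, rfl⟩
    induction t with
    | zero => simp
    | add x y hx hy => rw [map_add]; exact add_mem hx hy
    | tmul x y => exact Submodule.subset_span ⟨x, trivial, y, y.2, rfl⟩

/-- A tensor lies in `h ⊗ g + g ⊗ h` if and only if it is annihilated by `φ ⊗ ψ` for all
functionals `φ`, `ψ` vanishing on `h`. -/
theorem mem_tensorSub_sup_iff {K g : Type*} [Field K] [AddCommGroup g] [Module K g]
    [FiniteDimensional K g] (h : Submodule K g) (t : g ⊗[K] g) :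
    t ∈ tensorSub h ⊤ ⊔ tensorSub ⊤ h ↔
      ∀ φ ∈ h.dualAnnihilator, ∀ ψ ∈ h.dualAnnihilator, TensorProduct.map φ ψ t = 0 := by
  constructor
  · intro ht φ hφ ψ hψ
    rw [Submodule.mem_dualAnnihilator] at hφ hψ
    have hle : tensorSub h ⊤ ⊔ tensorSub ⊤ h ≤ LinearMap.ker (TensorProduct.map φ ψ) := by
      refine sup_le (Submodule.span_le.2 ?_) (Submodule.span_le.2 ?_)
      · rintro _ ⟨x, hx, y, -, rfl⟩
        simp [hφ x hx]
      · rintro _ ⟨x, -, y, hy, rfl⟩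
        simp [hψ y hy]
    exact hle ht
  · intro ht
    refine ker_map_mkQ_le_tensorSub_sup h
      (TensorProduct.eq_zero_of_forall_map_dual_eq_zero _ fun φ ψ => ?_)
    rw [← LinearMap.comp_apply, ← TensorProduct.map_comp]
    refine ht _ ?_ _ ?_ <;>
    · rw [Submodule.mem_dualAnnihilator]
      intro x hx
      simp [(Submodule.Quotient.mk_eq_zero h).2 hx]

/-- for a subspace `𝔥 ⊆ 𝔤`, the cocommutator `δ` (the transpose of the Lie
bracket `[·,·]_*` on `𝔤*`) satisfies the coisotropy condition `δ(𝔥) ⊆ 𝔥 ∧ 𝔤` if and only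
if the annihilator `𝔥^⊥` is a Lie subalgebra of `(𝔤*, [·,·]_*)`. -/
theorem coisotropy_iff_annihilator_subalgebra
    (K : Type*) [Field K] (g : Type*) [LieRing g] [LieAlgebra K g]
    [FiniteDimensional K g]
    [LieRing (Module.Dual K g)] [LieAlgebra K (Module.Dual K g)]
    (δ : g →ₗ[K] TensorProduct K g g)
    (hδ : ∀ (φ ψ : Module.Dual K g) (X : g),
      TensorProduct.lid K K (TensorProduct.map φ ψ (δ X)) = ⁅φ, ψ⁆ X)
    (h : Submodule K g) :
    (∀ X ∈ h, δ X ∈ tensorSub h ⊤ ⊔ tensorSub ⊤ h) ↔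
      (∀ φ ∈ h.dualAnnihilator, ∀ ψ ∈ h.dualAnnihilator,
        ⁅φ, ψ⁆ ∈ h.dualAnnihilator) := by
  simp only [mem_tensorSub_sup_iff]
  constructor
  · intro H φ hφ ψ hψ
    rw [Submodule.mem_dualAnnihilator]
    intro X hX
    rw [← hδ, H X hX φ hφ ψ hψ, map_zero]
  · intro H X hX φ hφ ψ hψ
    apply (TensorProduct.lid K K).injective
    rw [hδ, map_zero]
    exact (Submodule.mem_dualAnnihilator _).1 (H φ hφ ψ hψ) X hX
end

section
/- Let 𝔥, 𝔱 ⊆ 𝔤 be linear subspaces with 𝔤 = 𝔥 ⊕ 𝔱. Then the cocommutator satisfies the coreductivity condition δ(X) ∈ 𝔥 ⊗ 𝔥 + 𝔱 ⊗ 𝔱 for all X ∈ 𝔱 if and only if [φ,ψ]_* ∈ 𝔱^⊥ for all φ ∈ 𝔥^⊥ and ψ ∈ 𝔱^⊥ (i.e. [𝔥^⊥, 𝔱^⊥]_* ⊆ 𝔱^⊥). -/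
open TensorProduct

/-- A tensor in `V ⊗ V` on which all products `α ⊗ β` of functionals vanish is zero. -/
theorem tensor_eq_zero_of_forall_dual {K : Type*} [Field K] {V : Type*} [AddCommGroup V]
    [Module K V] (z : V ⊗[K] V)
    (hz : ∀ α β : V →ₗ[K] K, TensorProduct.lid K K (TensorProduct.map α β z) = 0) : z = 0 := by
  let b := Module.Basis.ofVectorSpace K V
  apply (b.tensorProduct b).ext_elem
  rintro ⟨i, j⟩
  have key : ∀ w : V ⊗[K] V, (b.tensorProduct b).repr w (i, j) =
      TensorProduct.lid K K (TensorProduct.map (b.coord i) (b.coord j) w) := by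
    intro w
    induction w with
    | zero => simp
    | tmul x y => simp [mul_comm]
    | add x y hx hy => simp [hx, hy]
  rw [key, hz]
  simp

theorem map_mem_tensorSub {K : Type*} [Field K] {V : Type*} [AddCommGroup V] [Module K V]
    {U W : Submodule K V} {p q : V →ₗ[K] V} (hp : ∀ x, p x ∈ U) (hq : ∀ x, q x ∈ W)
    (z : V ⊗[K] V) : TensorProduct.map p q z ∈ tensorSub U W := by
  induction z with
  | zero => simp
  | tmul x y => exact Submodule.subset_span ⟨p x, hp x, q y, hq y, rfl⟩
  | add x y hx hy => rw [map_add]; exact add_mem hx hy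

theorem tensorSub_le_ker_map {K : Type*} [Field K] {V : Type*} [AddCommGroup V] [Module K V]
    {U W : Submodule K V} {φ ψ : V →ₗ[K] K}
    (hφψ : (∀ x ∈ U, φ x = 0) ∨ ∀ y ∈ W, ψ y = 0) :
    tensorSub U W ≤ LinearMap.ker (TensorProduct.map φ ψ) := by
  refine Submodule.span_le.2 ?_
  rintro _ ⟨x, hx, y, hy, rfl⟩
  rcases hφψ with hφ | hψ
  · simp [hφ x hx]
  · simp [hψ y hy]

/-- The bracket on the dual is antisymmetric for the pointwise additive structure: the zero of
the Lie ring structure is the zero functional, since `δ` makes `⁅0, 0⁆` vanish pointwise. -/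
theorem dual_lie_apply_swap {K : Type*} [Field K] {g : Type*} [AddCommGroup g] [Module K g]
    [LieRing (Module.Dual K g)] (δ : g →ₗ[K] g ⊗[K] g)
    (hδ : ∀ (φ ψ : Module.Dual K g) (X : g),
      TensorProduct.lid K K (TensorProduct.map φ ψ (δ X)) = ⁅φ, ψ⁆ X)
    (φ ψ : g →ₗ[K] K) (X : g) :
    TensorProduct.lid K K (TensorProduct.map φ ψ (δ X)) =
      -TensorProduct.lid K K (TensorProduct.map ψ φ (δ X)) := by
  have self_eq_zero (χ : g →ₗ[K] K) :
      TensorProduct.lid K K (TensorProduct.map χ χ (δ X)) = 0 := by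
    have h0 := hδ (0 : g →ₗ[K] K) (0 : g →ₗ[K] K) X
    rw [lie_self, TensorProduct.map_zero_left] at h0
    rw [hδ, lie_self, ← h0]
    simp
  have hsum := self_eq_zero (φ + ψ)
  simp only [TensorProduct.map_add_left, TensorProduct.map_add_right, LinearMap.add_apply,
    map_add, self_eq_zero, zero_add, add_zero] at hsum
  exact eq_neg_of_add_eq_zero_right hsum

/-- for subspaces `𝔥, 𝔱 ⊆ 𝔤` with `𝔤 = 𝔥 ⊕ 𝔱`, the cocommutator `δ`
(the transpose of the Lie bracket `[·,·]_*` on `𝔤*`) satisfies the coreductivity condition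
`δ(𝔱) ⊆ 𝔥 ⊗ 𝔥 + 𝔱 ⊗ 𝔱` if and only if `[𝔥^⊥, 𝔱^⊥]_* ⊆ 𝔱^⊥`. -/
theorem coreductivity_iff_dual_bracket_condition
    (K : Type*) [Field K] (g : Type*) [LieRing g] [LieAlgebra K g]
    [FiniteDimensional K g]
    [LieRing (Module.Dual K g)] [LieAlgebra K (Module.Dual K g)]
    (δ : g →ₗ[K] TensorProduct K g g)
    (hδ : ∀ (φ ψ : Module.Dual K g) (X : g),
      TensorProduct.lid K K (TensorProduct.map φ ψ (δ X)) = ⁅φ, ψ⁆ X)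
    (h t : Submodule K g) (hcompl : IsCompl h t) :
    (∀ X ∈ t, δ X ∈ tensorSub h h ⊔ tensorSub t t) ↔
      (∀ φ ∈ h.dualAnnihilator, ∀ ψ ∈ t.dualAnnihilator,
        ⁅φ, ψ⁆ ∈ t.dualAnnihilator) := by
  constructor
  · intro H φ hφ ψ hψ
    rw [Submodule.mem_dualAnnihilator] at hφ hψ ⊢
    intro X hX
    have hker : tensorSub h h ⊔ tensorSub t t ≤ LinearMap.ker (TensorProduct.map φ ψ) :=
      sup_le (tensorSub_le_ker_map (Or.inl hφ)) (tensorSub_le_ker_map (Or.inr hψ))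
    rw [← hδ, LinearMap.mem_ker.1 (hker (H X hX)), map_zero]
  · intro H X hX
    let p := h.projection t hcompl
    let q := t.projection h hcompl.symm
    have hp : ∀ x, p x ∈ h := fun x => by simp [p]
    have hq : ∀ x, q x ∈ t := fun x => by simp [q]
    have hpt : ∀ x ∈ t, p x = 0 := fun x hx => by simpa [p] using hx
    have hqh : ∀ x ∈ h, q x = 0 := fun x hx => by simpa [q] using hx
    have hpq : p + q = LinearMap.id := Submodule.projection_add_projection_eq_id hcompl
    have vanish (α β : g →ₗ[K] K) :
        TensorProduct.lid K K (TensorProduct.map (α ∘ₗ q) (β ∘ₗ p) (δ X)) = 0 := by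
      rw [hδ]
      refine (Submodule.mem_dualAnnihilator _).1 (H (α ∘ₗ q) ?_ (β ∘ₗ p) ?_) X hX
      · exact (Submodule.mem_dualAnnihilator _).2 fun x hx => by simp [hqh x hx]
      · exact (Submodule.mem_dualAnnihilator _).2 fun x hx => by simp [hpt x hx]
    have hqp0 : TensorProduct.map q p (δ X) = 0 := tensor_eq_zero_of_forall_dual _ fun α β => by
      rw [← LinearMap.comp_apply (TensorProduct.map α β), ← TensorProduct.map_comp, vanish]
    have hpq0 : TensorProduct.map p q (δ X) = 0 := tensor_eq_zero_of_forall_dual _ fun α β => by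
      rw [← LinearMap.comp_apply (TensorProduct.map α β), ← TensorProduct.map_comp,
        dual_lie_apply_swap δ hδ, vanish, neg_zero]
    have decomp : δ X = TensorProduct.map p p (δ X) + TensorProduct.map q q (δ X) := by
      have hid : TensorProduct.map (p + q) (p + q) (δ X) = δ X := by
        rw [hpq, TensorProduct.map_id, LinearMap.id_apply]
      simpa [TensorProduct.map_add_left, TensorProduct.map_add_right, hpq0, hqp0] using hid.symm
    rw [decomp]
    exact Submodule.add_mem_sup (map_mem_tensorSub hp hp _) (map_mem_tensorSub hq hq _)
end

section
/- For every z, Λ ∈ ℝ, the bilinear skew-symmetric bracket on the 6-dimensional real vector space with basis {x̂⁰, x̂¹, x̂², ξ̂¹, ξ̂², θ̂} defined by [x̂⁰,x̂¹] = -z x̂¹, [x̂⁰,x̂²] = -z x̂², [x̂⁰,ξ̂¹] = -z ξ̂¹, [x̂⁰,ξ̂²] = -z ξ̂², [θ̂,x̂²] = -z ξ̂¹, [θ̂,ξ̂¹] = zΛ x̂², [θ̂,x̂¹] = z ξ̂², [θ̂,ξ̂²] = -zΛ x̂¹, with all other brackets of basis elements equal to zero, satisfies the Jacobi identity, and the resulting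 Lie algebra 𝔤* is solvable. -/
/-- The bilinear skew-symmetric bracket of the dual Lie algebra `𝔤*` of the κ-deformation
of the (2+1) Lorentzian Lie algebras, on the basis
`(x̂⁰, x̂¹, x̂², ξ̂¹, ξ̂², θ̂) = (e₀, ..., e₅)` of `ℝ⁶`:
`[x̂⁰,x̂¹] = -z x̂¹`, `[x̂⁰,x̂²] = -z x̂²`, `[x̂⁰,ξ̂¹] = -z ξ̂¹`, `[x̂⁰,ξ̂²] = -z ξ̂²`,
`[θ̂,x̂²] = -z ξ̂¹`, `[θ̂,ξ̂¹] = zΛ x̂²`, `[θ̂,x̂¹] = z ξ̂²`, `[θ̂,ξ̂²] = -zΛ x̂¹`,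
all other brackets of basis elements being zero, extended bilinearly. -/
def dualBracket (z Λ : ℝ) (X Y : Fin 6 → ℝ) : Fin 6 → ℝ :=
  ![0,
    -z * (X 0 * Y 1 - X 1 * Y 0) - z * Λ * (X 5 * Y 4 - X 4 * Y 5),
    -z * (X 0 * Y 2 - X 2 * Y 0) + z * Λ * (X 5 * Y 3 - X 3 * Y 5),
    -z * (X 0 * Y 3 - X 3 * Y 0) - z * (X 5 * Y 2 - X 2 * Y 5),
    -z * (X 0 * Y 4 - X 4 * Y 0) + z * (X 5 * Y 1 - X 1 * Y 5),
    0]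

/-- The derived series of the bracket `dualBracket z Λ`: `D⁰ = 𝔤*`,
`Dⁿ⁺¹ = span [Dⁿ, Dⁿ]`. -/
def dualDerivedSeries (z Λ : ℝ) : ℕ → Submodule ℝ (Fin 6 → ℝ)
  | 0 => ⊤
  | n + 1 =>
    Submodule.span ℝ {w : Fin 6 → ℝ |
      ∃ X ∈ dualDerivedSeries z Λ n, ∃ Y ∈ dualDerivedSeries z Λ n,
        w = dualBracket z Λ X Y}

theorem dualBracket_jacobi (z Λ : ℝ) (X Y Z : Fin 6 → ℝ) :
    dualBracket z Λ X (dualBracket z Λ Y Z)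
      + dualBracket z Λ Y (dualBracket z Λ Z X)
      + dualBracket z Λ Z (dualBracket z Λ X Y) = 0 := by
  ext i
  fin_cases i <;> simp [dualBracket] <;> ring

theorem dualBracket_eq_zero_of_apply_eq_zero (z Λ : ℝ) {X Y : Fin 6 → ℝ}
    (hX : X 0 = 0 ∧ X 5 = 0) (hY : Y 0 = 0 ∧ Y 5 = 0) : dualBracket z Λ X Y = 0 := by
  ext i
  fin_cases i <;> simp [dualBracket, hX, hY]

theorem apply_eq_zero_of_mem_dualDerivedSeries_one (z Λ : ℝ) {X : Fin 6 → ℝ}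
    (hX : X ∈ dualDerivedSeries z Λ 1) : X 0 = 0 ∧ X 5 = 0 := by
  rw [dualDerivedSeries] at hX
  induction hX using Submodule.span_induction with
  | mem w hw =>
    obtain ⟨U, -, V, -, rfl⟩ := hw
    simp [dualBracket]
  | zero => simp
  | add U V _ _ hU hV => simp [hU, hV]
  | smul a U _ hU => simp [hU]

theorem dualDerivedSeries_two (z Λ : ℝ) : dualDerivedSeries z Λ 2 = ⊥ := by
  rw [dualDerivedSeries, Submodule.span_eq_bot]
  rintro w ⟨X, hX, Y, hY, rfl⟩
  exact dualBracket_eq_zero_of_apply_eq_zero z Λ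
    (apply_eq_zero_of_mem_dualDerivedSeries_one z Λ hX)
    (apply_eq_zero_of_mem_dualDerivedSeries_one z Λ hY)

/-- for every `z, Λ ∈ ℝ`, the bracket `dualBracket z Λ` satisfies the Jacobi
identity, and the resulting Lie algebra `𝔤*` is solvable (its derived series terminates). -/
theorem dualBracket_jacobi_and_solvable (z Λ : ℝ) :
    (∀ X Y Z : Fin 6 → ℝ,
      dualBracket z Λ X (dualBracket z Λ Y Z)
        + dualBracket z Λ Y (dualBracket z Λ Z X)
        + dualBracket z Λ Z (dualBracket z Λ X Y) = 0) ∧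
    (∃ n : ℕ, dualDerivedSeries z Λ n = ⊥) :=
  ⟨dualBracket_jacobi z Λ, 2, dualDerivedSeries_two z Λ⟩
end
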